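/- Let ρ be the half-sum of the positive roots of g, and ρ∨ the half-sum of the positive coroots. For each β_j ∈ K, let g⟨j⟩ be the simple subalgebra of g with root system Δ⟨j⟩, and let h(g⟨j⟩) and h*(g⟨j⟩) denote its Coxeter number and dual Coxeter number, respectively. Then 2ρ = Σ_{j=1}^m (h*(g⟨j⟩) − 1)·β_j and 2ρ∨ = Σ_{j=1}^m (h(g⟨j⟩) − 1)·β_j∨. -/

import Mathlib

open scoped RealInnerProductSpace

attribute [local instance] Classical.propDecidable

section RootCombinatorics

variable {V : Type*} [NormedAddCommGroup V] [InnerProductSpace ℝ V]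

/-- The Cartan pairing `⟨γ, α∨⟩ = 2 (γ, α) / (α, α)`. -/
noncomputable def cartanPairing (γ α : V) : ℝ := 2 * ⟪γ, α⟫ / ⟪α, α⟫

/-- The coroot `γ∨ = 2 γ / (γ, γ)`. -/
noncomputable def covec (γ : V) : V := (2 / ⟪γ, γ⟫) • γ

/-- The cascade element `x_K = Σ_{β ∈ K} β / (β, β) = ½ Σ_{β ∈ K} β∨`. -/
noncomputable def cascElt (K : Finset V) : V := ∑ β ∈ K, (⟪β, β⟫)⁻¹ • β

/-- The roots of `S` orthogonal to `β`. -/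
noncomputable def orthSub (S : Finset V) (β : V) : Finset V := S.filter fun γ => ⟪γ, β⟫ = 0

/-- One step of the non-orthogonality (connectedness) relation inside `S`. -/
def connRel (S : Finset V) (a b : V) : Prop := a ∈ S ∧ b ∈ S ∧ ⟪a, b⟫ ≠ 0

/-- The irreducible component of the root subsystem `S` containing `γ`. -/
noncomputable def component (S : Finset V) (γ : V) : Finset V :=
  S.filter fun γ' => Relation.ReflTransGen (connRel S) γ γ'

/-- `C` is an irreducible component of the root subsystem `S`. -/
def IsComponent (S C : Finset V) : Prop := ∃ γ ∈ S, C = component S γ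

end RootCombinatorics

/-- The combinatorial data of an irreducible crystallographic root system with a chosen
system of positive roots, base (set of simple roots) and highest root: the combinatorial
skeleton of a finite-dimensional complex simple Lie algebra, with the Killing-form
identification of the Cartan subalgebra and its dual. -/
structure RootSystemCtx (V : Type*) [NormedAddCommGroup V] [InnerProductSpace ℝ V] where
  /-- the set of roots Δ -/
  Δ : Finset V
  /-- the set of simple roots Π -/
  base : Finset V
  /-- the set of positive roots Δ⁺ -/
  Pos : Finset V
  /-- the highest root θ -/
  θ : V
  zero_not_mem : (0 : V) ∉ Δ
  neg_mem : ∀ γ ∈ Δ, -γ ∈ Δ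
  reflect_mem : ∀ α ∈ Δ, ∀ γ ∈ Δ, γ - cartanPairing γ α • α ∈ Δ
  pairing_int : ∀ α ∈ Δ, ∀ γ ∈ Δ, ∃ k : ℤ, cartanPairing γ α = (k : ℝ)
  span_eq : Submodule.span ℝ (Δ : Set V) = ⊤
  base_subset : base ⊆ Pos
  base_indep : LinearIndependent ℝ (fun a : {x // x ∈ base} => (a : V))
  pos_subset : Pos ⊆ Δ
  pos_or_neg : ∀ γ ∈ Δ, γ ∈ Pos ∨ -γ ∈ Pos
  pos_not_neg : ∀ γ ∈ Pos, -γ ∉ Pos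
  pos_coords : ∀ γ ∈ Pos, γ ∈ AddSubmonoid.closure (base : Set V)
  irreducible : ∀ S : Finset V, S ⊆ Δ → S.Nonempty →
    (∀ a ∈ S, ∀ b ∈ Δ, b ∉ S → ⟪a, b⟫ = 0) → S = Δ
  theta_mem : θ ∈ Pos
  theta_highest : ∀ γ ∈ Δ, θ - γ ∈ AddSubmonoid.closure (base : Set V)

namespace RootSystemCtx

variable {V : Type*} [NormedAddCommGroup V] [InnerProductSpace ℝ V]

variable (ctx : RootSystemCtx V)

/-- The root order `γ ≼ γ'` on roots: `γ' - γ` is a nonnegative integral combination of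
simple roots. -/
def rootLE (γ γ' : V) : Prop := γ' - γ ∈ AddSubmonoid.closure (ctx.base : Set V)

/-- `β` is the highest root of the root subsystem `S` (with respect to the ambient positive
system). -/
def IsHighest (S : Finset V) (β : V) : Prop :=
  β ∈ S ∧ β ∈ ctx.Pos ∧ ∀ γ ∈ S, ctx.rootLE γ β

/-- `CascadeMem ctx S β` : the pair (root subsystem `S = Δ⟨i⟩`, its highest root `β = βᵢ`)
occurs in the recursive construction of the Kostant cascade: one starts with `(Δ, θ)`, and the
descendants of `(S, β)` are the pairs `(C, β')` where `C` is an irreducible component of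
`{γ ∈ S | (γ, β) = 0}` and `β'` is the highest root of `C`. -/
inductive CascadeMem : Finset V → V → Prop
  | top : CascadeMem ctx.Δ ctx.θ
  | step {S C : Finset V} {β β' : V} : CascadeMem S β →
      IsComponent (orthSub S β) C → ctx.IsHighest C β' → CascadeMem C β'

/-- `K` is the Kostant cascade of the root system. -/
def IsCascade (K : Finset V) : Prop := ∀ β, β ∈ K ↔ ∃ S, ctx.CascadeMem S β

/-- The Heisenberg subset `H_β = {γ ∈ S ∩ Δ⁺ : (γ, β) > 0}` attached to a cascade pair
`(S, β)`. -/
noncomputable def heis (S : Finset V) (β : V) : Finset V :=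
  S.filter fun γ => γ ∈ ctx.Pos ∧ 0 < ⟪γ, β⟫

/-- A root is long if it has the same length as the highest root. -/
def IsLong (γ : V) : Prop := ⟪γ, γ⟫ = ⟪ctx.θ, ctx.θ⟫

/-- The highest root `θ` is a fundamental weight. -/
def ThetaFundamental : Prop :=
  ∃ α ∈ ctx.base, cartanPairing ctx.θ α = 1 ∧
    ∀ β ∈ ctx.base, β ≠ α → cartanPairing ctx.θ β = 0

/-- `β'` is a descendant of the cascade element `β`. -/
def Desc (β β' : V) : Prop :=
  ∃ S C, ctx.CascadeMem S β ∧ IsComponent (orthSub S β) C ∧ ctx.IsHighest C β'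

/-- The cascade poset order: `β ≤ β'` iff `β` is an iterated descendant of `β'`. -/
def cascLE (β β' : V) : Prop := Relation.ReflTransGen (fun a b => ctx.Desc b a) β β'

/-- A simple reflection of the root system. -/
def IsSimpleReflection (w : V ≃ₗ[ℝ] V) : Prop :=
  ∃ α ∈ ctx.base, ∀ v, w v = v - (2 * ⟪v, α⟫ / ⟪α, α⟫) • α

/-- The Weyl group, generated by the simple reflections. -/
def weylGroup : Subgroup (V ≃ₗ[ℝ] V) := Subgroup.closure {w | ctx.IsSimpleReflection w}

/-- The length of a Weyl group element: the minimal number of simple reflections needed to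
express it. -/
noncomputable def length (w : V ≃ₗ[ℝ] V) : ℕ :=
  sInf {n | ∃ l : List (V ≃ₗ[ℝ] V), l.length = n ∧
    (∀ s ∈ l, ctx.IsSimpleReflection s) ∧ l.prod = w}

/-- The root system is of type `Aₙ` (Cartan matrix characterisation). -/
def IsTypeA (n : ℕ) : Prop :=
  1 ≤ n ∧ ∃ e : Fin n ≃ {x // x ∈ ctx.base}, ∀ i j : Fin n,
    cartanPairing (e i : V) (e j : V) =
      (if i = j then 2 else if i.val + 1 = j.val ∨ j.val + 1 = i.val then -1 else 0)

/-- The root system is of type `Bₙ` (`n ≥ 2`), with the last simple root short. -/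
def IsTypeB (n : ℕ) : Prop :=
  2 ≤ n ∧ ∃ e : Fin n ≃ {x // x ∈ ctx.base}, ∀ i j : Fin n,
    cartanPairing (e i : V) (e j : V) =
      (if i = j then 2
       else if i.val + 2 = n ∧ j.val + 1 = n then -2
       else if i.val + 1 = j.val ∨ j.val + 1 = i.val then -1 else 0)

/-- The root system is of type `Cₙ` (`n ≥ 2`), with the last simple root long. -/
def IsTypeC (n : ℕ) : Prop :=
  2 ≤ n ∧ ∃ e : Fin n ≃ {x // x ∈ ctx.base}, ∀ i j : Fin n,
    cartanPairing (e i : V) (e j : V) =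
      (if i = j then 2
       else if i.val + 1 = n ∧ j.val + 2 = n then -2
       else if i.val + 1 = j.val ∨ j.val + 1 = i.val then -1 else 0)

/-- The root system is of type `G₂` (first simple root short). -/
def IsTypeG2 : Prop :=
  ∃ e : Fin 2 ≃ {x // x ∈ ctx.base},
    cartanPairing (e 0 : V) (e 0 : V) = 2 ∧ cartanPairing (e 1 : V) (e 1 : V) = 2 ∧
    cartanPairing (e 0 : V) (e 1 : V) = -1 ∧ cartanPairing (e 1 : V) (e 0 : V) = -3

/-- The set of roots `Δ(a_z) = w(Δ⁺_z(-1)) ∪ w(-Δ⁺_z(2))` of the abelian ideal attached by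
Kostant's construction to `z` (with `w = w_z`). -/
def idealSet (w : V ≃ₗ[ℝ] V) (x : V) : Set V :=
  {δ | ∃ γ ∈ ctx.Pos, (⟪γ, x⟫ = -1 ∧ δ = w γ) ∨ (⟪γ, x⟫ = 2 ∧ δ = -(w γ))}

end RootSystemCtx

section Reflections

variable {V : Type*} [NormedAddCommGroup V] [InnerProductSpace ℝ V]

lemma inner_self_pos_of_ne_zero {x : V} (hx : x ≠ 0) : 0 < ⟪x, x⟫ :=
  real_inner_self_pos.2 hx

lemma cartanPairing_self {x : V} (hx : x ≠ 0) : cartanPairing x x = 2 := by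
  have := inner_self_pos_of_ne_zero hx
  unfold cartanPairing
  field_simp

lemma cartanPairing_mul_inner (x : V) {y : V} (hy : y ≠ 0) :
    cartanPairing x y * ⟪y, y⟫ = 2 * ⟪x, y⟫ := by
  have := inner_self_pos_of_ne_zero hy
  unfold cartanPairing
  field_simp

/-- The negative of the reflection in `β`. -/
noncomputable def negReflection (β x : V) : V := cartanPairing x β • β - x

lemma inner_negReflection {β : V} (hβ : β ≠ 0) (x : V) :
    ⟪negReflection β x, β⟫ = ⟪x, β⟫ := by
  have := cartanPairing_mul_inner x hβ
  rw [negReflection, inner_sub_left, real_inner_smul_left]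
  linarith

lemma negReflection_negReflection {β : V} (hβ : β ≠ 0) (x : V) :
    negReflection β (negReflection β x) = x := by
  have h : cartanPairing (negReflection β x) β = cartanPairing x β := by
    simp only [cartanPairing, inner_negReflection hβ]
  rw [negReflection, h, negReflection, sub_sub_cancel]

lemma inner_self_negReflection {β : V} (hβ : β ≠ 0) (x : V) :
    ⟪negReflection β x, negReflection β x⟫ = ⟪x, x⟫ := by
  have h := cartanPairing_mul_inner x hβ
  rw [negReflection, inner_sub_left, real_inner_smul_left, inner_sub_right, inner_sub_right,
    real_inner_smul_right, real_inner_smul_right, real_inner_comm x β]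
  linear_combination cartanPairing x β * h

/-- A sum over a set stable under `negReflection β` of vectors rescaled by a function of their
length is proportional to `β`. -/
lemma sum_smul_eq_of_negReflection_mem {β : V} (hβ : β ≠ 0) (H : Finset V)
    (hH : ∀ γ ∈ H, negReflection β γ ∈ H) (g : ℝ → ℝ) :
    ∑ γ ∈ H, g ⟪γ, γ⟫ • γ = (⟪∑ γ ∈ H, g ⟪γ, γ⟫ • γ, β⟫ / ⟪β, β⟫) • β := by
  have hswap : ∑ γ ∈ H, g ⟪γ, γ⟫ • γ = ∑ γ ∈ H, g ⟪γ, γ⟫ • negReflection β γ :=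
    Finset.sum_nbij' (negReflection β) (negReflection β) hH hH
      (fun γ _ => negReflection_negReflection hβ γ)
      (fun γ _ => negReflection_negReflection hβ γ)
      (fun γ _ => by rw [inner_self_negReflection hβ, negReflection_negReflection hβ])
  have hsum : ∑ γ ∈ H, g ⟪γ, γ⟫ • negReflection β γ =
      (2 * (⟪∑ γ ∈ H, g ⟪γ, γ⟫ • γ, β⟫ / ⟪β, β⟫)) • β - ∑ γ ∈ H, g ⟪γ, γ⟫ • γ := by
    rw [sum_inner, Finset.sum_div, Finset.mul_sum, Finset.sum_smul, ← Finset.sum_sub_distrib]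
    refine Finset.sum_congr rfl fun γ _ => ?_
    rw [negReflection, smul_sub, smul_smul, real_inner_smul_left]
    congr 2
    unfold cartanPairing
    ring
  have h2 : (2 : ℝ) • ∑ γ ∈ H, g ⟪γ, γ⟫ • γ =
      (2 : ℝ) • ((⟪∑ γ ∈ H, g ⟪γ, γ⟫ • γ, β⟫ / ⟪β, β⟫) • β) := by
    rw [smul_smul, two_smul]
    nth_rw 1 [hswap]
    rw [hsum, sub_add_cancel]
  exact smul_right_injective V (two_ne_zero' ℝ) h2

end Reflections

section Components

variable {V : Type*} [NormedAddCommGroup V] [InnerProductSpace ℝ V]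

lemma mem_orthSub {S : Finset V} {β γ : V} : γ ∈ orthSub S β ↔ γ ∈ S ∧ ⟪γ, β⟫ = 0 := by
  simp [orthSub]

lemma mem_component {S : Finset V} {γ δ : V} :
    δ ∈ component S γ ↔ δ ∈ S ∧ Relation.ReflTransGen (connRel S) γ δ := by
  simp [component]

lemma component_subset (S : Finset V) (γ : V) : component S γ ⊆ S := Finset.filter_subset _ _

lemma connRel_symm {S : Finset V} {a b : V} (h : connRel S a b) : connRel S b a :=
  ⟨h.2.1, h.1, by rw [real_inner_comm]; exact h.2.2⟩

lemma reflTransGen_connRel_symm {S : Finset V} {a b : V}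
    (h : Relation.ReflTransGen (connRel S) a b) : Relation.ReflTransGen (connRel S) b a := by
  induction h with
  | refl => exact .refl
  | tail _ h ih => exact ih.head (connRel_symm h)

lemma component_eq_of_mem {S : Finset V} {γ δ : V} (h : δ ∈ component S γ) :
    component S γ = component S δ := by
  have h' := (mem_component.1 h).2
  ext x
  rw [mem_component, mem_component]
  exact and_congr_right fun _ =>
    ⟨fun hx => (reflTransGen_connRel_symm h').trans hx, fun hx => h'.trans hx⟩

lemma IsComponent.eq_component {S C : Finset V} (h : IsComponent S C) {γ : V} (hγ : γ ∈ C) :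
    C = component S γ := by
  obtain ⟨δ, -, rfl⟩ := h
  exact component_eq_of_mem hγ

end Components

namespace RootSystemCtx

variable {V : Type*} [NormedAddCommGroup V] [InnerProductSpace ℝ V] (ctx : RootSystemCtx V)

/-- A set of roots stable under its own reflections. -/
structure IsSubsystem (S : Finset V) : Prop where
  subset : S ⊆ ctx.Δ
  reflect : ∀ α ∈ S, ∀ γ ∈ S, γ - cartanPairing γ α • α ∈ S

variable {ctx}

lemma ne_zero_of_mem {γ : V} (h : γ ∈ ctx.Δ) : γ ≠ 0 := by
  rintro rfl
  exact ctx.zero_not_mem h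

variable (ctx) in
/-- There is a height function: it takes the value `1` on every simple root. -/
lemma exists_height : ∃ f : V →ₗ[ℝ] ℝ, ∀ a ∈ ctx.base, f a = 1 := by
  let b := Module.Basis.span ctx.base_indep
  obtain ⟨f, hf⟩ := LinearMap.exists_extend (b.constr ℝ fun _ => (1 : ℝ))
  refine ⟨f, fun a ha => ?_⟩
  have h := LinearMap.congr_fun hf (b ⟨a, ha⟩)
  rw [Module.Basis.constr_basis, LinearMap.comp_apply] at h
  rw [← h]
  congr 1
  simp [b, Module.Basis.span_apply]

lemma height_nonneg {f : V →ₗ[ℝ] ℝ} (hf : ∀ a ∈ ctx.base, f a = 1) {x : V}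
    (hx : x ∈ AddSubmonoid.closure (ctx.base : Set V)) : x = 0 ∨ 0 < f x := by
  induction hx using AddSubmonoid.closure_induction with
  | mem x hx => right; rw [hf x hx]; exact one_pos
  | zero => exact Or.inl rfl
  | add x y _ _ hx hy =>
    rcases hx with rfl | hx
    · simpa using hy
    · rcases hy with rfl | hy
      · right; simpa using hx
      · right; rw [map_add]; exact add_pos hx hy

lemma height_pos {f : V →ₗ[ℝ] ℝ} (hf : ∀ a ∈ ctx.base, f a = 1) {γ : V} (hγ : γ ∈ ctx.Pos) :
    0 < f γ :=
  (height_nonneg hf (ctx.pos_coords γ hγ)).resolve_left (ne_zero_of_mem (ctx.pos_subset hγ))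

lemma eq_zero_of_mem_closure_of_neg_mem_closure {x : V}
    (hx : x ∈ AddSubmonoid.closure (ctx.base : Set V))
    (hx' : -x ∈ AddSubmonoid.closure (ctx.base : Set V)) : x = 0 := by
  obtain ⟨f, hf⟩ := ctx.exists_height
  rcases height_nonneg hf hx with h | h
  · exact h
  · rcases height_nonneg hf hx' with h' | h'
    · exact neg_eq_zero.1 h'
    · rw [map_neg] at h'; linarith

lemma mem_pos_of_mem_closure {γ : V} (hγ : γ ∈ ctx.Δ)
    (h : γ ∈ AddSubmonoid.closure (ctx.base : Set V)) : γ ∈ ctx.Pos :=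
  (ctx.pos_or_neg γ hγ).resolve_right fun hn =>
    ne_zero_of_mem hγ (eq_zero_of_mem_closure_of_neg_mem_closure h (ctx.pos_coords _ hn))

lemma isSubsystem_roots : ctx.IsSubsystem ctx.Δ := ⟨subset_rfl, ctx.reflect_mem⟩

namespace IsSubsystem

variable {S : Finset V}

lemma ne_zero (hS : ctx.IsSubsystem S) {γ : V} (h : γ ∈ S) : γ ≠ 0 := ne_zero_of_mem (hS.subset h)

lemma neg_mem (hS : ctx.IsSubsystem S) {γ : V} (h : γ ∈ S) : -γ ∈ S := by
  have := hS.reflect γ h γ h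
  rwa [cartanPairing_self (hS.ne_zero h), two_smul, sub_add_cancel_left] at this

lemma negReflection_mem (hS : ctx.IsSubsystem S) {β γ : V} (hβ : β ∈ S) (hγ : γ ∈ S) :
    negReflection β γ ∈ S := by
  have := hS.neg_mem (hS.reflect β hβ γ hγ)
  rwa [neg_sub] at this

lemma orthSub (hS : ctx.IsSubsystem S) (β : V) : ctx.IsSubsystem (orthSub S β) where
  subset := (Finset.filter_subset _ _).trans hS.subset
  reflect α hα γ hγ := by
    rw [mem_orthSub] at *
    refine ⟨hS.reflect α hα.1 γ hγ.1, ?_⟩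
    rw [inner_sub_left, real_inner_smul_left, hα.2, hγ.2, mul_zero, sub_zero]

lemma component (hS : ctx.IsSubsystem S) (δ : V) : ctx.IsSubsystem (component S δ) where
  subset := (component_subset S δ).trans hS.subset
  reflect α hα γ hγ := by
    have hα' := component_subset S δ hα
    have hγ' := component_subset S δ hγ
    by_cases h : ⟪γ, α⟫ = 0
    · simpa [cartanPairing, h] using hγ
    · rw [mem_component] at hα ⊢
      refine ⟨hS.reflect α hα' γ hγ', hα.2.tail ⟨hα', hS.reflect α hα' γ hγ', ?_⟩⟩
      rw [inner_sub_right, real_inner_smul_right, cartanPairing_mul_inner γ (hS.ne_zero hα'),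
        real_inner_comm]
      contrapose! h
      linarith

/-- If two distinct roots form an acute angle, their difference is a root. -/
lemma sub_mem_of_inner_pos (hS : ctx.IsSubsystem S) {γ δ : V} (hγ : γ ∈ S)
    (hδ : δ ∈ S) (h : 0 < ⟪γ, δ⟫) (hne : γ ≠ δ) : γ - δ ∈ S := by
  obtain ⟨k, hk⟩ := ctx.pairing_int δ (hS.subset hδ) γ (hS.subset hγ)
  obtain ⟨l, hl⟩ := ctx.pairing_int γ (hS.subset hγ) δ (hS.subset hδ)
  have hk' := cartanPairing_mul_inner γ (hS.ne_zero hδ)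
  have hl' := cartanPairing_mul_inner δ (hS.ne_zero hγ)
  rw [real_inner_comm γ δ] at hl'
  have hγ0 := inner_self_pos_of_ne_zero (hS.ne_zero hγ)
  have hδ0 := inner_self_pos_of_ne_zero (hS.ne_zero hδ)
  have hsub : 0 < ⟪γ - δ, γ - δ⟫ := inner_self_pos_of_ne_zero (sub_ne_zero.2 hne)
  rw [real_inner_sub_sub_self] at hsub
  rw [hk] at hk'
  rw [hl] at hl'
  by_cases h1 : k = 1
  · have := hS.reflect δ hδ γ hγ
    rwa [hk, h1, Int.cast_one, one_smul] at this
  by_cases h2 : l = 1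
  · have := hS.neg_mem (hS.reflect γ hγ δ hδ)
    rwa [hl, h2, Int.cast_one, one_smul, neg_sub] at this
  exfalso
  have k0 : 0 < k := by
    have : (0 : ℝ) < k := by
      by_contra! hc
      nlinarith
    exact_mod_cast this
  have l0 : 0 < l := by
    have : (0 : ℝ) < l := by
      by_contra! hc
      nlinarith
    exact_mod_cast this
  have k2 : (2 : ℝ) ≤ k := by exact_mod_cast (by omega : (2 : ℤ) ≤ k)
  have l2 : (2 : ℝ) ≤ l := by exact_mod_cast (by omega : (2 : ℤ) ≤ l)
  nlinarith

end IsSubsystem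

section Highest

variable {S : Finset V} {β : V}

lemma IsHighest.unique {β' : V} (hβ : ctx.IsHighest S β) (hβ' : ctx.IsHighest S β') :
    β = β' := by
  have h1 := hβ.2.2 β' hβ'.1
  have h2 := hβ'.2.2 β hβ.1
  refine sub_eq_zero.1 (eq_zero_of_mem_closure_of_neg_mem_closure h1 ?_)
  rwa [neg_sub]

/-- Roots forming an acute angle with the highest root are positive. -/
lemma IsHighest.mem_pos_of_inner_pos (hβ : ctx.IsHighest S β) (hS : ctx.IsSubsystem S)
    {γ : V} (hγ : γ ∈ S) (h : 0 < ⟪γ, β⟫) : γ ∈ ctx.Pos := by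
  refine mem_pos_of_mem_closure (hS.subset hγ) ?_
  obtain ⟨k, hk⟩ := ctx.pairing_int β (hS.subset hβ.1) γ (hS.subset hγ)
  have hle := hβ.2.2 _ (hS.negReflection_mem hβ.1 hγ)
  have hk' := cartanPairing_mul_inner γ (hS.ne_zero hβ.1)
  have hβ0 := inner_self_pos_of_ne_zero (hS.ne_zero hβ.1)
  have k0 : 0 < k := by
    have : (0 : ℝ) < k := by
      rw [hk] at hk'
      by_contra! hc
      nlinarith
    exact_mod_cast this
  obtain ⟨n, rfl⟩ : ∃ n : ℕ, k = n + 1 := ⟨(k - 1).toNat, by omega⟩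
  have hsum := add_mem hle (AddSubmonoid.nsmul_mem _ (ctx.pos_coords β hβ.2.1) n)
  convert hsum using 1
  rw [negReflection, hk, ← Nat.cast_smul_eq_nsmul ℝ]
  push_cast
  module

lemma IsHighest.inner_nonneg_of_mem_pos (hβ : ctx.IsHighest S β) (hS : ctx.IsSubsystem S)
    {γ : V} (hγ : γ ∈ S) (h : γ ∈ ctx.Pos) :
    0 ≤ ⟪γ, β⟫ := by
  by_contra! hc
  refine ctx.pos_not_neg γ h (hβ.mem_pos_of_inner_pos hS (hS.neg_mem hγ) ?_)
  rw [inner_neg_left]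
  linarith

lemma IsHighest.sum_acute_smul (hβ : ctx.IsHighest S β) (hS : ctx.IsSubsystem S)
    (g : ℝ → ℝ) :
    ∑ γ ∈ S with 0 < ⟪γ, β⟫, g ⟪γ, γ⟫ • γ =
      (⟪∑ γ ∈ S with γ ∈ ctx.Pos, g ⟪γ, γ⟫ • γ, β⟫ / ⟪β, β⟫) • β := by
  have hβ0 := hS.ne_zero hβ.1
  rw [sum_smul_eq_of_negReflection_mem hβ0]
  · congr 2
    rw [sum_inner, sum_inner]
    refine Finset.sum_subset (fun γ hγ => ?_) fun γ hγ hγ' => ?_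
    · rw [Finset.mem_filter] at *
      exact ⟨hγ.1, hβ.mem_pos_of_inner_pos hS hγ.1 hγ.2⟩
    · rw [Finset.mem_filter] at *
      have h0 := hβ.inner_nonneg_of_mem_pos hS hγ.1 hγ.2
      have : ⟪γ, β⟫ = 0 := le_antisymm (not_lt.1 fun h => hγ' ⟨hγ.1, h⟩) h0
      rw [real_inner_smul_left, this, mul_zero]
  · intro γ hγ
    rw [Finset.mem_filter] at *
    exact ⟨hS.negReflection_mem hβ.1 hγ.1, by rw [inner_negReflection hβ0]; exact hγ.2⟩

end Highest

/-- In an irreducible subsystem, any root is non-orthogonal to a neighbour of any other one. -/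
lemma exists_common_neighbour {S : Finset V} (hS : ctx.IsSubsystem S) {β γ : V} (hβ : β ∈ S)
    (h : Relation.ReflTransGen (connRel S) β γ) :
    ∃ ε ∈ component S β, ⟪ε, β⟫ ≠ 0 ∧ ⟪γ, ε⟫ ≠ 0 := by
  have hC := hS.component β
  induction h with
  | refl =>
    have := (inner_self_pos_of_ne_zero (hS.ne_zero hβ)).ne'
    exact ⟨β, mem_component.2 ⟨hβ, .refl⟩, this, this⟩
  | @tail δ γ hδ hγ ih =>
    obtain ⟨ε, hε, hεβ, hδε⟩ := ih
    have hδC : δ ∈ component S β := mem_component.2 ⟨hγ.1, hδ⟩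
    have hγδ : ⟪γ, δ⟫ ≠ 0 := (connRel_symm hγ).2.2
    by_cases hδβ : ⟪δ, β⟫ = 0
    · by_cases hγε : ⟪γ, ε⟫ = 0
      · refine ⟨_, hC.reflect δ hδC ε hε, ?_, ?_⟩
        · rwa [inner_sub_left, real_inner_smul_left, hδβ, mul_zero, sub_zero]
        · rw [inner_sub_right, real_inner_smul_right, hγε, zero_sub, neg_ne_zero]
          refine mul_ne_zero (fun h0 => hδε ?_) hγδ
          have := cartanPairing_mul_inner ε (hC.ne_zero hδC)
          rw [h0, zero_mul, real_inner_comm] at this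
          linarith
      · exact ⟨ε, hε, hεβ, hγε⟩
    · exact ⟨δ, hδC, hδβ, hγδ⟩

lemma exists_isHighest_component {S : Finset V} (hS : ctx.IsSubsystem S) {δ : V} (hδ : δ ∈ S) :
    ∃ β, ctx.IsHighest (component S δ) β := by
  obtain ⟨f, hf⟩ := ctx.exists_height
  obtain ⟨β, hβ, hmax⟩ := Finset.exists_max_image (component S δ) f
    ⟨δ, mem_component.2 ⟨hδ, .refl⟩⟩
  rw [component_eq_of_mem hβ] at *
  have hC := hS.component β
  have hβpos : β ∈ ctx.Pos := by
    refine (ctx.pos_or_neg β (hC.subset hβ)).resolve_right fun hn => ?_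
    have h1 := height_pos hf hn
    have h2 := hmax _ (hC.neg_mem hβ)
    rw [map_neg] at h1 h2
    linarith
  have hle : ∀ γ ∈ component S β, 0 < ⟪γ, β⟫ → ctx.rootLE γ β := by
    intro γ hγ h
    by_cases hne : β = γ
    · rw [rootLE, hne, sub_self]; exact zero_mem _
    · have hmem := hC.sub_mem_of_inner_pos hβ hγ (by rwa [real_inner_comm]) hne
      refine ctx.pos_coords _ ((ctx.pos_or_neg _ (hC.subset hmem)).resolve_right fun hn => ?_)
      have h1 := height_pos hf hn
      have h2 := hmax _ hγ
      rw [map_neg, map_sub] at h1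
      linarith
  have hpos : ∀ γ ∈ component S β, 0 < ⟪γ, β⟫ → γ ∈ ctx.Pos := by
    intro γ hγ h
    refine (ctx.pos_or_neg γ (hC.subset hγ)).resolve_right fun hn => ?_
    by_cases hne : β = γ
    · exact ctx.pos_not_neg β hβpos (hne ▸ hn)
    · have hmem := hC.sub_mem_of_inner_pos hβ hγ (by rwa [real_inner_comm]) hne
      have h1 := height_pos hf hn
      have h2 := hmax _ hmem
      rw [map_neg] at h1
      rw [map_sub] at h2
      linarith
  have hβcl := ctx.pos_coords β hβpos
  refine ⟨β, hβ, hβpos, fun γ hγ => ?_⟩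
  rcases lt_trichotomy 0 ⟪γ, β⟫ with h | h | h
  · exact hle γ hγ h
  · obtain ⟨ε, hε, hεβ, hγε⟩ : ∃ ε ∈ component S β, 0 < ⟪ε, β⟫ ∧ ⟪γ, ε⟫ ≠ 0 := by
      obtain ⟨ε, hε, h1, h2⟩ :=
        exists_common_neighbour hS (component_subset _ _ hβ) (mem_component.1 hγ).2
      rcases lt_or_gt_of_ne h1 with h1 | h1
      · exact ⟨-ε, hC.neg_mem hε, by rw [inner_neg_left]; linarith,
          by rwa [inner_neg_right, neg_ne_zero]⟩
      · exact ⟨ε, hε, h1, h2⟩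
    rcases lt_or_gt_of_ne hγε with hneg | hgt
    · have hne : γ ≠ -ε := by
        rintro rfl
        rw [inner_neg_left] at h
        linarith
      have hmem := hC.sub_mem_of_inner_pos hγ (hC.neg_mem hε)
        (by rw [inner_neg_right]; linarith) hne
      have h1 := hle _ hmem (by rw [sub_neg_eq_add, inner_add_left]; linarith)
      have h2 := add_mem h1 (ctx.pos_coords ε (hpos ε hε hεβ))
      rw [rootLE]
      convert h2 using 1
      abel
    · have hne : ε ≠ γ := by
        rintro rfl
        linarith
      have hmem := hC.sub_mem_of_inner_pos hε hγ (by rwa [real_inner_comm]) hne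
      have h1 := ctx.pos_coords _ (hpos _ hmem (by rw [inner_sub_left]; linarith))
      have h2 := add_mem (hle ε hε hεβ) h1
      rw [rootLE]
      convert h2 using 1
      abel
  · have h1 := ctx.pos_coords _
      (hpos (-γ) (hC.neg_mem hγ) (by rw [inner_neg_left]; linarith))
    rw [rootLE, sub_eq_add_neg]
    exact add_mem hβcl h1

section Cascade

lemma CascadeMem.isSubsystem {S : Finset V} {β : V} (h : ctx.CascadeMem S β) :
    ctx.IsSubsystem S := by
  induction h with
  | top => exact isSubsystem_roots
  | step _ hC _ ih =>
    obtain ⟨γ, -, rfl⟩ := hC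
    exact (ih.orthSub _).component γ

lemma CascadeMem.isHighest {S : Finset V} {β : V} (h : ctx.CascadeMem S β) :
    ctx.IsHighest S β := by
  cases h with
  | top => exact ⟨ctx.pos_subset ctx.theta_mem, ctx.theta_mem, ctx.theta_highest⟩
  | step _ _ hβ => exact hβ

/-- Every positive root of a cascade subsystem lies in the Heisenberg subset of a cascade
pair. -/
lemma CascadeMem.exists_inner_pos {S : Finset V} {β : V} (h : ctx.CascadeMem S β) {γ : V}
    (hγS : γ ∈ S) (hγ : γ ∈ ctx.Pos) :
    ∃ S' β', ctx.CascadeMem S' β' ∧ γ ∈ S' ∧ 0 < ⟪γ, β'⟫ := by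
  induction S using Finset.strongInduction generalizing β with
  | H S ih =>
    rcases (h.isHighest.inner_nonneg_of_mem_pos h.isSubsystem hγS hγ).lt_or_eq with hlt | heq
    · exact ⟨S, β, h, hγS, hlt⟩
    · have hmem : γ ∈ orthSub S β := mem_orthSub.2 ⟨hγS, heq.symm⟩
      obtain ⟨β', hβ'⟩ := exists_isHighest_component (h.isSubsystem.orthSub β) hmem
      have hsub : component (orthSub S β) γ ⊆ orthSub S β := component_subset _ _
      refine ih _ ?_ (h.step ⟨γ, hmem, rfl⟩ hβ') (mem_component.2 ⟨hmem, .refl⟩)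
      refine (Finset.ssubset_iff_of_subset (hsub.trans (Finset.filter_subset _ _))).2
        ⟨β, h.isHighest.1, fun hβ => ?_⟩
      exact (inner_self_pos_of_ne_zero (h.isSubsystem.ne_zero h.isHighest.1)).ne'
        (mem_orthSub.1 (hsub hβ)).2

variable (ctx) in
/-- The step of the cascade construction that stays in the component containing `γ`. -/
noncomputable def cascadeNext (γ : V) (p : Finset V × V) : Finset V × V :=
  (component (orthSub p.1 p.2) γ,
    Classical.epsilon (ctx.IsHighest (component (orthSub p.1 p.2) γ)))

lemma CascadeMem.exists_iterate {S : Finset V} {β : V} (h : ctx.CascadeMem S β) {γ : V}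
    (hγ : γ ∈ S) : ∃ n, (ctx.cascadeNext γ)^[n] (ctx.Δ, ctx.θ) = (S, β) := by
  induction h with
  | top => exact ⟨0, rfl⟩
  | @step S C β β' _ hC hβ' ih =>
    obtain rfl := hC.eq_component hγ
    obtain ⟨n, hn⟩ := ih (mem_orthSub.1 (component_subset _ _ hγ)).1
    refine ⟨n + 1, ?_⟩
    rw [Function.iterate_succ_apply', hn, cascadeNext]
    exact Prod.ext rfl ((Classical.epsilon_spec ⟨β', hβ'⟩).unique hβ')

lemma cascadeNext_iterate_subset (γ : V) (p : Finset V × V) (n : ℕ) :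
    ((ctx.cascadeNext γ)^[n + 1] p).1 ⊆ orthSub p.1 p.2 := by
  induction n with
  | zero => exact component_subset _ _
  | succ n ih =>
    rw [Function.iterate_succ_apply']
    exact ((component_subset _ _).trans (Finset.filter_subset _ _)).trans ih

lemma inner_eq_zero_of_iterate_lt {γ β β' : V} {S S' : Finset V} {p : Finset V × V} {m n : ℕ}
    (hm : (ctx.cascadeNext γ)^[m] p = (S, β)) (hn : (ctx.cascadeNext γ)^[n] p = (S', β'))
    (hγ : γ ∈ S') (hmn : m < n) : ⟪γ, β⟫ = 0 := by
  obtain ⟨d, rfl⟩ := Nat.exists_eq_add_of_lt hmn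
  rw [show m + d + 1 = (d + 1) + m by ring, Function.iterate_add_apply, hm] at hn
  have h := cascadeNext_iterate_subset (ctx := ctx) γ (S, β) d
  rw [hn] at h
  exact (mem_orthSub.1 (h hγ)).2

/-- A root belongs to at most one Heisenberg subset of the cascade. -/
lemma CascadeMem.unique {S S' : Finset V} {β β' γ : V} (h : ctx.CascadeMem S β)
    (h' : ctx.CascadeMem S' β') (hγ : γ ∈ S) (hγ' : γ ∈ S') (hne : ⟪γ, β⟫ ≠ 0)
    (hne' : ⟪γ, β'⟫ ≠ 0) : S = S' ∧ β = β' := by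
  obtain ⟨m, hm⟩ := h.exists_iterate hγ
  obtain ⟨n, hn⟩ := h'.exists_iterate hγ'
  rcases lt_trichotomy m n with hlt | rfl | hlt
  · exact absurd (inner_eq_zero_of_iterate_lt hm hn hγ' hlt) hne
  · exact Prod.mk.inj (hm.symm.trans hn)
  · exact absurd (inner_eq_zero_of_iterate_lt hn hm hγ hlt) hne'

/-- The decomposition of a sum over positive roots, rescaled by a function of their lengths,
along the Kostant cascade. -/
lemma sum_pos_smul_eq_sum_cascade {K : Finset V} (hK : ctx.IsCascade K) {Sub : V → Finset V}
    (hSub : ∀ β ∈ K, ctx.CascadeMem (Sub β) β) (g : ℝ → ℝ) :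
    ∑ γ ∈ ctx.Pos, g ⟪γ, γ⟫ • γ =
      ∑ β ∈ K, (⟪∑ γ ∈ Sub β with γ ∈ ctx.Pos, g ⟪γ, γ⟫ • γ, β⟫ / ⟪β, β⟫) • β := by
  have hPos : ctx.Pos = K.biUnion fun β => (Sub β).filter fun γ => 0 < ⟪γ, β⟫ := by
    ext γ
    simp only [Finset.mem_biUnion, Finset.mem_filter]
    constructor
    · intro hγ
      obtain ⟨S, β, h, hγS, hpos⟩ := CascadeMem.top.exists_inner_pos (ctx.pos_subset hγ) hγ
      have hβK : β ∈ K := (hK β).2 ⟨S, h⟩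
      have h' := hSub β hβK
      have hβ0 := (inner_self_pos_of_ne_zero (h.isSubsystem.ne_zero h.isHighest.1)).ne'
      obtain ⟨rfl, -⟩ := h.unique h' h.isHighest.1 h'.isHighest.1 hβ0 hβ0
      exact ⟨β, hβK, hγS, hpos⟩
    · rintro ⟨β, hβ, hγS, hpos⟩
      exact (hSub β hβ).isHighest.mem_pos_of_inner_pos (hSub β hβ).isSubsystem hγS hpos
  rw [hPos, Finset.sum_biUnion, ← hPos]
  · exact Finset.sum_congr rfl fun β hβ =>
      (hSub β hβ).isHighest.sum_acute_smul (hSub β hβ).isSubsystem g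
  · intro β hβ β' hβ' hne
    refine Finset.disjoint_left.2 fun γ hγ hγ' => hne ?_
    rw [Finset.mem_filter] at hγ hγ'
    exact ((hSub β hβ).unique (hSub β' hβ') hγ.1 hγ'.1 hγ.2.ne' hγ'.2.ne').2

end Cascade

end RootSystemCtx

/-- `2ρ = Σ_j (h*(g⟨j⟩) - 1) β_j` and `2ρ∨ = Σ_j (h(g⟨j⟩) - 1) β_j∨`, where
`h(g⟨j⟩) = (ρ∨_{Δ⟨j⟩}, β_j) + 1` and `h*(g⟨j⟩) = (ρ_{Δ⟨j⟩}, β_j∨) + 1` are the Coxeter and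
dual Coxeter numbers of the cascade subalgebra `g⟨j⟩`. -/
theorem two_rho_cascade {V : Type*} [NormedAddCommGroup V] [InnerProductSpace ℝ V]
    [FiniteDimensional ℝ V] (ctx : RootSystemCtx V)
    (K : Finset V) (hK : ctx.IsCascade K)
    (Sub : V → Finset V) (hSub : ∀ β ∈ K, ctx.CascadeMem (Sub β) β) :
    ((∑ γ ∈ ctx.Pos, γ) =
      ∑ β ∈ K,
        ((⟪(2⁻¹ : ℝ) • ∑ γ ∈ (Sub β).filter (· ∈ ctx.Pos), γ, covec β⟫ + 1) - 1) • β) ∧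
    ((∑ γ ∈ ctx.Pos, covec γ) =
      ∑ β ∈ K,
        ((⟪(2⁻¹ : ℝ) • ∑ γ ∈ (Sub β).filter (· ∈ ctx.Pos), covec γ, β⟫ + 1) - 1) • covec β) := by
  have hβ0 : ∀ β ∈ K, ⟪β, β⟫ ≠ 0 := fun β hβ =>
    (inner_self_pos_of_ne_zero
      ((hSub β hβ).isSubsystem.ne_zero (hSub β hβ).isHighest.1)).ne'
  constructor
  · have h := RootSystemCtx.sum_pos_smul_eq_sum_cascade hK hSub fun _ => 1
    simp only [one_smul] at h
    rw [h]
    refine Finset.sum_congr rfl fun β hβ => ?_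
    have := hβ0 β hβ
    rw [covec, real_inner_smul_left, real_inner_smul_right]
    congr 1
    field_simp
    ring
  · have h := RootSystemCtx.sum_pos_smul_eq_sum_cascade hK hSub fun t => 2 / t
    simp only [covec]
    rw [h]
    refine Finset.sum_congr rfl fun β hβ => ?_
    have := hβ0 β hβ
    rw [real_inner_smul_left, smul_smul]
    congr 1
    field_simp
    ring
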